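/- There is an absolute constant C > 0 such that for all positive integers n, p and even q the following hold. (i) The number of sequences (c^1,…,c^s) with s ≥ 1 and c^1,…,c^s ∈ {0,1,…,q/2}^p for which 𝒞(c^1,…,c^s) ≠ ∅ is at most C^{pq} · p^{pq/2}. (ii) If 𝒞(c^1,…,c^s) ≠ ∅, then |𝒞(c^1,…,c^s)| ≤ (n^s / s!) · ((q/2)!)^p / ∏_{ℓ=1}^p (c^1_ℓ! · c^2_ℓ! ⋯ c^s_ℓ!). -/

import Mathlib

open scoped BigOperators

noncomputable section

/-- The ±1-valued tensor associated with a Boolean sign pattern. -/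
def signT {n d : ℕ} (A : (Fin d → Fin n) → Bool) : (Fin d → Fin n) → ℝ :=
  fun K => if A K then 1 else -1

/-- Expectation of `g` over a random order-`d` tensor with i.i.d. uniform ±1 entries. -/
def texp (n d : ℕ) (g : ((Fin d → Fin n) → ℝ) → ℝ) : ℝ :=
  (∑ A : (Fin d → Fin n) → Bool, g (signT A)) / (Fintype.card ((Fin d → Fin n) → Bool) : ℝ)

/-- Probability of event `P` over a random order-`d` tensor with i.i.d. uniform ±1 entries. -/
def tprob (n d : ℕ) (P : ((Fin d → Fin n) → ℝ) → Prop) : ℝ :=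
  (Nat.card {A : (Fin d → Fin n) → Bool // P (signT A)} : ℝ) /
    (Fintype.card ((Fin d → Fin n) → Bool) : ℝ)

/-- Operator (ℓ₂→ℓ₂) norm of a rectangular array, as the sup of `|uᵀ M v|` over unit vectors. -/
def opNorm {ι κ : Type*} [Fintype ι] [Fintype κ] (M : ι → κ → ℝ) : ℝ :=
  sSup {r : ℝ | ∃ (u : EuclideanSpace ℝ ι) (v : EuclideanSpace ℝ κ),
    ‖u‖ = 1 ∧ ‖v‖ = 1 ∧ r = |∑ i, ∑ j, u i * M i j * v j|}

/-- Largest eigenvalue of a symmetric array, as the sup of Rayleigh quotients. -/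
def lamMax {ι : Type*} [Fintype ι] (M : ι → ι → ℝ) : ℝ :=
  sSup {r : ℝ | ∃ y : EuclideanSpace ℝ ι, ‖y‖ = 1 ∧ r = ∑ i, ∑ j, y i * M i j * y j}

/-- Number of occurrences of `v` among the coordinates of the tuple `I`. -/
def cnt {n k : ℕ} (I : Fin k → Fin n) (v : Fin n) : ℕ :=
  (Finset.univ.filter fun ℓ => I ℓ = v).card

/-- The set `O(δ)` of tuples whose multi-index is `δ`. -/
def Oset (n k : ℕ) (δ : Fin n → ℕ) : Finset (Fin k → Fin n) :=
  Finset.univ.filter fun K => ∀ v, cnt K v = δ v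

/-- The set of elements of `[n]` occurring among the coordinates of `I¹, …, Iᵖ`. -/
def occSet {n h p : ℕ} (I : Fin p → Fin h → Fin n) : Finset (Fin n) :=
  Finset.univ.filter fun v => ∃ ℓ j, I ℓ j = v

/-- Membership in the class `𝒞(c¹,…,cˢ)`: there are exactly `s` distinct occurring
elements and the `k`-th smallest occurring element appears `c k ℓ` times in `Iˡ`. -/
def inC {n h p s : ℕ} (c : Fin s → Fin p → ℕ) (I : Fin p → Fin h → Fin n) : Prop :=
  ∃ hcard : (occSet I).card = s,
    ∀ (k : Fin s) (ℓ : Fin p),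
      cnt (I ℓ) (((occSet I).orderIsoOfFin hcard k : Fin n)) = c k ℓ

/-- Concatenation of two half-tuples of length `d/2` into a tuple of length `d` (`d` even). -/
def halfConcat {n : ℕ} (d : ℕ) (hd : d % 2 = 0) (K₁ K₂ : Fin (d / 2) → Fin n) :
    Fin d → Fin n :=
  fun t => if h : (t : ℕ) < d / 2 then K₁ ⟨t, h⟩
           else K₂ ⟨(t : ℕ) - d / 2, by have ht := t.isLt; omega⟩

/-- The position in `[q/2]` of the `r`-th entry of the `m`-th block of length `d/2`. -/
def blockIdx (d q : ℕ) (m : Fin (q / d)) (r : Fin (d / 2)) : Fin (q / 2) :=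
  ⟨(m : ℕ) * (d / 2) + (r : ℕ), by
    have hm : (m : ℕ) < q / d := m.isLt
    have hr : (r : ℕ) < d / 2 := r.isLt
    have h3 : q / d * (d / 2) ≤ q / 2 := by
      have h4 : q / d * d ≤ q := Nat.div_mul_le_self q d
      have h6 : q / d * (d / 2) * 2 ≤ q / d * d := by
        have h5 : d / 2 * 2 ≤ d := by omega
        calc q / d * (d / 2) * 2 = q / d * (d / 2 * 2) := by ring
          _ ≤ q / d * d := Nat.mul_le_mul (le_refl _) h5
      omega
    have h7 : ((m : ℕ) + 1) * (d / 2) ≤ q / d * (d / 2) :=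
      Nat.mul_le_mul (by omega) (le_refl _)
    have h8 : ((m : ℕ) + 1) * (d / 2) = (m : ℕ) * (d / 2) + d / 2 := by ring
    omega⟩

/-- Row-column independent symmetrization of `A^{⊗ q/d}`. -/
def rcSym (n d q : ℕ) (hd : d % 2 = 0) (A : (Fin d → Fin n) → ℝ)
    (I J : Fin (q / 2) → Fin n) : ℝ :=
  ((Nat.factorial (q / 2) : ℝ))⁻¹ ^ 2 *
    ∑ π : Equiv.Perm (Fin (q / 2)), ∑ σ : Equiv.Perm (Fin (q / 2)),
      ∏ m : Fin (q / d),
        A (halfConcat d hd (fun r => I (π (blockIdx d q m r)))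
            (fun r => J (σ (blockIdx d q m r))))

/-- `E(I¹,…,Iᵖ) = 𝔼[∏_ℓ M[Iˡ, Iˡ⁺¹]]` (cyclically). -/
def Efun (n d q p : ℕ) (hd : d % 2 = 0) (hp : p ≠ 0)
    (I : Fin p → Fin (q / 2) → Fin n) : ℝ :=
  haveI : NeZero p := ⟨hp⟩
  texp n d fun A => ∏ ℓ : Fin p, rcSym n d q hd A (I ℓ) (I (ℓ + 1))

/-- `Tr(M^p)` for the row-column independent symmetrization `M` of `A^{⊗ q/d}`. -/
def trMpow (n d q p : ℕ) (hd : d % 2 = 0) (hp : p ≠ 0)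
    (A : (Fin d → Fin n) → ℝ) : ℝ :=
  haveI : NeZero p := ⟨hp⟩
  ∑ I : Fin p → Fin (q / 2) → Fin n, ∏ ℓ : Fin p, rcSym n d q hd A (I ℓ) (I (ℓ + 1))

/-- `𝒯 = Σ_ℓ T_ℓ ⊗ T_ℓ`, where `T_ℓ` is the symmetrized `ℓ`-th slice of the 3-tensor `A`. -/
def calT (n : ℕ) (A : (Fin 3 → Fin n) → ℝ) (u v : Fin n × Fin n) : ℝ :=
  ∑ ℓ : Fin n,
    ((A ![ℓ, u.1, v.1] + A ![ℓ, v.1, u.1]) / 2) *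
    ((A ![ℓ, u.2, v.2] + A ![ℓ, v.2, u.2]) / 2)

/-- `T = 𝒯 - D`, where `D` is the restriction of `𝒯` to entries `[(i,i),(j,j)]`. -/
def Tmat (n : ℕ) (A : (Fin 3 → Fin n) → ℝ) (u v : Fin n × Fin n) : ℝ :=
  calT n A u v - (if u.1 = u.2 ∧ v.1 = v.2 then calT n A u v else 0)

/-- The position in `[q/2]` of the `r`-th entry of the `g`-th pair. -/
def pairIdx (q : ℕ) (g : Fin (q / 4)) (r : Fin 2) : Fin (q / 2) :=
  ⟨2 * (g : ℕ) + (r : ℕ), by have hg := g.isLt; have hr := r.isLt; omega⟩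

/-- `𝖠 = T^{⊗ q/4}` as a `[n]^{q/2} × [n]^{q/2}` array. -/
def bigA3 (n q : ℕ) (A : (Fin 3 → Fin n) → ℝ) (I J : Fin (q / 2) → Fin n) : ℝ :=
  ∏ g : Fin (q / 4),
    Tmat n A (I (pairIdx q g 0), I (pairIdx q g 1)) (J (pairIdx q g 0), J (pairIdx q g 1))

/-- The row-column symmetrized matrix `B`. -/
def Bmat (n q : ℕ) (A : (Fin 3 → Fin n) → ℝ) (I J : Fin (q / 2) → Fin n) : ℝ :=
  ((Nat.factorial (q / 2) : ℝ))⁻¹ ^ 2 *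
    ∑ π : Equiv.Perm (Fin (q / 2)), ∑ σ : Equiv.Perm (Fin (q / 2)),
      bigA3 n q A (fun t => I (π t)) (fun t => J (σ t))

/-- `E(I¹,…,Iᵖ) = 𝔼[∏_ℓ B[Iˡ, Iˡ⁺¹]]` (cyclically), for the 3-tensor case. -/
def E3fun (n q p : ℕ) (hp : p ≠ 0) (I : Fin p → Fin (q / 2) → Fin n) : ℝ :=
  haveI : NeZero p := ⟨hp⟩
  texp n 3 fun A => ∏ ℓ : Fin p, Bmat n q A (I ℓ) (I (ℓ + 1))

/-- Concatenation of two tuples of length `q/2` into a tuple of length `q` (`q` even). -/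
def tupConcat {n : ℕ} (q : ℕ) (hq : q % 2 = 0) (I J : Fin (q / 2) → Fin n) :
    Fin q → Fin n :=
  fun t => if h : (t : ℕ) < q / 2 then I ⟨t, h⟩
           else J ⟨(t : ℕ) - q / 2, by have ht := t.isLt; omega⟩

end

/-- Number of functions with a prescribed histogram. -/
theorem hist_card_le {n h : ℕ} (f0 : Fin h → Fin n) :
    Fintype.card {f : Fin h → Fin n // ∀ v, cnt f v = cnt f0 v} * ∏ v, (cnt f0 v).factorial
      ≤ h.factorial := by
  classical
  have hst : Fintype.card {g : Equiv.Perm (Fin h) // f0 ∘ g = f0} =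
      ∏ v, (cnt f0 v).factorial := by
    rw [DomMulAct.stabilizer_card]
    refine Finset.prod_congr rfl fun v _ => ?_
    rw [Fintype.card_subtype]; rfl
  rw [← hst, ← Fintype.card_prod]
  have hex : ∀ f : {f : Fin h → Fin n // ∀ v, cnt f v = cnt f0 v},
      ∃ σ : Equiv.Perm (Fin h), ∀ a, f0 (σ a) = f.1 a := by
    intro f
    have e : ∀ v, Nonempty ({a // f.1 a = v} ≃ {a // f0 a = v}) := by
      intro v
      apply Fintype.card_eq.mp
      rw [Fintype.card_subtype, Fintype.card_subtype]
      exact f.2 v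
    exact ⟨Equiv.ofFiberEquiv fun v => (e v).some, fun a => Equiv.ofFiberEquiv_map _ a⟩
  choose σ hσ using hex
  have := Fintype.card_le_of_injective
    (fun x : {f : Fin h → Fin n // ∀ v, cnt f v = cnt f0 v} ×
      {g : Equiv.Perm (Fin h) // f0 ∘ g = f0} => x.2.1 * σ x.1) (by
    rintro ⟨f, g⟩ ⟨f', g'⟩ hh
    simp only at hh
    have key : ∀ (f : {f : Fin h → Fin n // ∀ v, cnt f v = cnt f0 v})
        (g : {g : Equiv.Perm (Fin h) // f0 ∘ g = f0}) a, f0 ((g.1 * σ f) a) = f.1 a := by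
      intro f g a
      rw [Equiv.Perm.mul_apply, ← hσ f a]
      exact congrFun g.2 (σ f a)
    have hf : f = f' := by
      apply Subtype.ext
      funext a
      rw [← key f g a, ← key f' g' a, hh]
    subst hf
    have hg : g = g' := Subtype.ext (mul_right_cancel hh)
    rw [hg])
  simpa [Fintype.card_perm] using this

theorem cnt_eq_zero {n h p : ℕ} (I : Fin p → Fin h → Fin n) (ℓ : Fin p) (v : Fin n)
    (hv : v ∉ occSet I) : cnt (I ℓ) v = 0 := by
  unfold cnt
  rw [Finset.card_eq_zero, Finset.filter_eq_empty_iff]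
  intro j _ hj
  apply hv
  simp only [occSet, Finset.mem_filter, Finset.mem_univ, true_and]
  exact ⟨ℓ, j, hj⟩

theorem prod_cnt {n h p s : ℕ} (c : Fin s → Fin p → ℕ) (I : Fin p → Fin h → Fin n)
    (hI : inC c I) (ℓ : Fin p) :
    ∏ v, (cnt (I ℓ) v).factorial = ∏ k, (c k ℓ).factorial := by
  obtain ⟨hc, hI⟩ := hI
  rw [← Finset.prod_subset (Finset.subset_univ (occSet I))
    (fun v _ hv => by rw [cnt_eq_zero I ℓ v hv]; rfl)]
  rw [← Finset.prod_coe_sort]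
  rw [← Equiv.prod_comp ((occSet I).orderIsoOfFin hc).toEquiv]
  refine Finset.prod_congr rfl fun k _ => ?_
  rw [← hI k ℓ]; rfl

theorem sum_cnt {n h p s : ℕ} (c : Fin s → Fin p → ℕ) (I : Fin p → Fin h → Fin n)
    (hI : inC c I) (ℓ : Fin p) : ∑ k, c k ℓ = h := by
  obtain ⟨hc, hI⟩ := hI
  have h1 : ∑ k, c k ℓ = ∑ v, cnt (I ℓ) v := by
    rw [← Finset.sum_subset (Finset.subset_univ (occSet I))
      (fun v _ hv => cnt_eq_zero I ℓ v hv)]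
    rw [← Finset.sum_coe_sort (occSet I)]
    rw [← Equiv.sum_comp ((occSet I).orderIsoOfFin hc).toEquiv]
    refine Finset.sum_congr rfl fun k _ => ?_
    rw [← hI k ℓ]; rfl
  rw [h1]
  have := Finset.card_eq_sum_card_fiberwise (f := I ℓ) (s := Finset.univ) (t := Finset.univ)
    (fun _ _ => by simp)
  rw [Finset.card_univ, Fintype.card_fin] at this
  exact this.symm

theorem row_ne_zero {n h p s : ℕ} (c : Fin s → Fin p → ℕ) (I : Fin p → Fin h → Fin n)
    (hI : inC c I) (k : Fin s) : c k ≠ 0 := by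
  obtain ⟨hc, hI⟩ := hI
  intro h0
  have hm := ((occSet I).orderIsoOfFin hc k).2
  simp only [occSet, Finset.mem_filter, Finset.mem_univ, true_and] at hm
  obtain ⟨ℓ, j, hj⟩ := hm
  have := hI k ℓ
  rw [h0] at this
  simp only [cnt, Pi.zero_apply, Finset.card_eq_zero, Finset.filter_eq_empty_iff] at this
  exact this (Finset.mem_univ j) hj

theorem cnt_eq_of_occ {n h p s : ℕ} (c : Fin s → Fin p → ℕ) (I J : Fin p → Fin h → Fin n)
    (hI : inC c I) (hJ : inC c J) (hIJ : occSet I = occSet J) (ℓ : Fin p) (v : Fin n) :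
    cnt (I ℓ) v = cnt (J ℓ) v := by
  by_cases hv : v ∈ occSet I
  · obtain ⟨hc, hI⟩ := hI
    obtain ⟨hc', hJ⟩ := hJ
    obtain ⟨k, hk⟩ := ((occSet I).orderIsoOfFin hc).surjective ⟨v, hv⟩
    have h1 := hI k ℓ
    have h2 := hJ k ℓ
    have h3 : (((occSet J).orderIsoOfFin hc' k : Fin n)) = v := by
      have : (((occSet J).orderIsoOfFin hc' k : Fin n)) =
        (((occSet I).orderIsoOfFin hc k : Fin n)) := by
        simp only [Finset.coe_orderIsoOfFin_apply]
        congr 1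
        simp only [hIJ]
      rw [this, hk]
    rw [hk] at h1
    rw [h3] at h2
    rw [h2]; exact h1
  · rw [cnt_eq_zero I ℓ v hv, cnt_eq_zero J ℓ v (hIJ ▸ hv)]

theorem class_card_le {n h p s : ℕ} (c : Fin s → Fin p → ℕ) :
    Nat.card {I : Fin p → Fin h → Fin n // inC c I} * ∏ ℓ, ∏ k, (c k ℓ).factorial
      ≤ n.choose s * h.factorial ^ p := by
  classical
  rw [Nat.card_eq_fintype_card, Fintype.card_subtype]
  have hfib : (Finset.univ.filter fun I : Fin p → Fin h → Fin n => inC c I).card =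
      ∑ S ∈ Finset.powersetCard s (Finset.univ : Finset (Fin n)),
        ((Finset.univ.filter fun I : Fin p → Fin h → Fin n => inC c I).filter
          fun I => occSet I = S).card := by
    apply Finset.card_eq_sum_card_fiberwise
    intro I hI
    simp only [Finset.coe_filter, Finset.mem_univ, true_and] at hI
    obtain ⟨hc, -⟩ := hI
    simp [Finset.mem_powersetCard, hc]
  rw [hfib, Finset.sum_mul]
  calc _ ≤ ∑ S ∈ Finset.powersetCard s (Finset.univ : Finset (Fin n)), h.factorial ^ p := by
        refine Finset.sum_le_sum fun S _ => ?_
        rcases Finset.eq_empty_or_nonempty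
          ((Finset.univ.filter fun I : Fin p → Fin h → Fin n => inC c I).filter
          fun I => occSet I = S) with he | ⟨J, hJ⟩
        · rw [he]; simp
        simp only [Finset.mem_filter, Finset.mem_univ, true_and] at hJ
        have h1 : ((Finset.univ.filter fun I : Fin p → Fin h → Fin n => inC c I).filter
            fun I => occSet I = S).card ≤
            ∏ ℓ, Fintype.card {f : Fin h → Fin n // ∀ v, cnt f v = cnt (J ℓ) v} := by
          rw [← Fintype.card_pi, ← Fintype.card_coe]
          refine Fintype.card_le_of_injective (fun I ℓ => ⟨I.1 ℓ, fun v => ?_⟩) ?_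
          · have := I.2
            simp only [Finset.mem_filter, Finset.mem_univ, true_and] at this
            exact cnt_eq_of_occ c I.1 J this.1 hJ.1 (this.2.trans hJ.2.symm) ℓ v
          · intro I I' hh
            apply Subtype.ext
            funext ℓ
            exact congrArg Subtype.val (congrFun hh ℓ)
        refine (Nat.mul_le_mul_right _ h1).trans ?_
        rw [← Finset.prod_mul_distrib]
        calc _ ≤ ∏ _ℓ : Fin p, h.factorial := by
              refine Finset.prod_le_prod' fun ℓ _ => ?_
              rw [← prod_cnt c J hJ.1 ℓ]
              exact hist_card_le (J ℓ)
          _ = _ := by simp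
    _ = _ := by simp

/-- Decoding of words over `Fin p × Bool` into sequences of vectors. -/
def decodeWord {p : ℕ} : List (Fin p × Bool) → List (Fin p → ℕ)
  | [] => []
  | (i, b) :: l =>
    if b then Pi.single i 1 :: decodeWord l
    else match decodeWord l with
      | [] => []
      | v :: t => (v + Pi.single i 1) :: t

theorem decodeWord_surj {p : ℕ} (N : ℕ) : ∀ L : List (Fin p → ℕ), (∀ v ∈ L, v ≠ 0) →
    (L.map fun v => ∑ i, v i).sum = N → ∃ l : List (Fin p × Bool), l.length = N ∧
      decodeWord l = L := by
  induction N with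
  | zero =>
    intro L hL hs
    cases L with
    | nil => exact ⟨[], rfl, rfl⟩
    | cons v t =>
      exfalso
      simp only [List.map_cons, List.sum_cons, Nat.add_eq_zero_iff] at hs
      apply hL v (by simp)
      funext i
      exact (Finset.sum_eq_zero_iff.mp hs.1) i (Finset.mem_univ i)
  | succ N ih =>
    intro L hL hs
    cases L with
    | nil => simp at hs
    | cons v t =>
      have hv := hL v (by simp)
      obtain ⟨i, hi⟩ := Function.ne_iff.mp hv
      simp only [Pi.zero_apply] at hi
      have hle : Pi.single i 1 ≤ v := by
        intro j
        by_cases hj : j = i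
        · subst hj; simp; omega
        · simp [hj]
      obtain ⟨w, hw⟩ := exists_add_of_le hle
      have hsum : ∑ j, v j = 1 + ∑ j, w j := by
        rw [hw]; simp [Finset.sum_add_distrib]
      simp only [List.map_cons, List.sum_cons] at hs
      by_cases hw0 : w = 0
      · obtain ⟨l, hl, hd⟩ := ih t (fun u hu => hL u (by simp [hu])) (by
          subst hw0; simp at hsum; omega)
        exact ⟨(i, true) :: l, by simp [hl], by simp [decodeWord, hd, hw, hw0]⟩
      · obtain ⟨l, hl, hd⟩ := ih (w :: t) (by
          intro u hu
          rcases List.mem_cons.mp hu with rfl | hu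
          · exact hw0
          · exact hL u (by simp [hu])) (by simp only [List.map_cons, List.sum_cons]; omega)
        exact ⟨(i, false) :: l, by simp [hl], by simp [decodeWord, hd, hw, add_comm]⟩

theorem seq_card_le (n p h : ℕ) :
    Nat.card {x : Σ s : ℕ, Fin s → Fin p → Fin (h + 1) //
          0 < x.1 ∧ ∃ I : Fin p → Fin h → Fin n,
            inC (fun k ℓ => ((x.2 k ℓ : ℕ))) I} ≤ (p * 2) ^ (p * h) := by
  classical
  have hex : ∀ x : {x : Σ s : ℕ, Fin s → Fin p → Fin (h + 1) //
          0 < x.1 ∧ ∃ I : Fin p → Fin h → Fin n,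
            inC (fun k ℓ => ((x.2 k ℓ : ℕ))) I},
      ∃ l : List.Vector (Fin p × Bool) (p * h),
        decodeWord l.1 = List.ofFn (fun k ℓ => ((x.1.2 k ℓ : ℕ))) := by
    rintro ⟨⟨s, c⟩, -, I, hI⟩
    simp only at hI ⊢
    obtain ⟨l, hl, hd⟩ := decodeWord_surj (p * h) (List.ofFn (fun k ℓ => ((c k ℓ : ℕ)))) (by
      intro v hv
      rw [List.mem_ofFn] at hv
      obtain ⟨k, rfl⟩ := hv
      exact row_ne_zero _ I hI k) (by
      rw [List.map_ofFn, List.sum_ofFn]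
      simp only [Function.comp]
      rw [Finset.sum_comm, Finset.sum_congr rfl fun ℓ _ => sum_cnt _ I hI ℓ]
      simp)
    exact ⟨⟨l, hl⟩, hd⟩
  choose F hF using hex
  have hinj : Function.Injective F := by
    rintro ⟨⟨s, c⟩, hx⟩ ⟨⟨s', c'⟩, hx'⟩ hh
    have h1 := hF ⟨⟨s, c⟩, hx⟩
    have h2 := hF ⟨⟨s', c'⟩, hx'⟩
    rw [hh, h2] at h1
    simp only at h1
    have hs : s' = s := by simpa using congrArg List.length h1
    subst hs
    have h3 := List.ofFn_injective h1
    apply Subtype.ext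
    simp only [Sigma.mk.injEq, heq_eq_eq, true_and]
    funext k ℓ
    exact Fin.ext (congrFun (congrFun h3 k) ℓ).symm
  have := Nat.card_le_card_of_injective F hinj
  refine this.trans (le_of_eq ?_)
  rw [Nat.card_eq_fintype_card, card_vector]
  simp

theorem stmt_6 : ∃ C : ℝ, 0 < C ∧
    ∀ (n p q : ℕ), 1 ≤ n → 1 ≤ p → q % 2 = 0 →
      ((Nat.card {x : Σ s : ℕ, Fin s → Fin p → Fin (q / 2 + 1) //
          0 < x.1 ∧ ∃ I : Fin p → Fin (q / 2) → Fin n,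
            inC (fun k ℓ => ((x.2 k ℓ : ℕ))) I} : ℝ) ≤
        C ^ (p * q) * (p : ℝ) ^ ((p : ℝ) * (q : ℝ) / 2)) ∧
      (∀ (s : ℕ) (c : Fin s → Fin p → ℕ), (∀ k ℓ, c k ℓ ≤ q / 2) →
        (∃ I : Fin p → Fin (q / 2) → Fin n, inC c I) →
        (Nat.card {I : Fin p → Fin (q / 2) → Fin n // inC c I} : ℝ) ≤
          (n : ℝ) ^ s / (Nat.factorial s : ℝ) * (Nat.factorial (q / 2) : ℝ) ^ p /
            ∏ ℓ : Fin p, ∏ k : Fin s, (Nat.factorial (c k ℓ) : ℝ)) := by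
  refine ⟨2, by norm_num, fun n p q hn hp hq => ⟨?_, ?_⟩⟩
  · have h1 := seq_card_le n p (q / 2)
    have h2 : ((Nat.card {x : Σ s : ℕ, Fin s → Fin p → Fin (q / 2 + 1) //
          0 < x.1 ∧ ∃ I : Fin p → Fin (q / 2) → Fin n,
            inC (fun k ℓ => ((x.2 k ℓ : ℕ))) I} : ℝ)) ≤ ((p : ℝ) * 2) ^ (p * (q / 2)) := by
      exact_mod_cast h1
    refine h2.trans ?_
    have h3 : (p : ℝ) * (q : ℝ) / 2 = ((p * (q / 2) : ℕ) : ℝ) := by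
      have : (q : ℝ) = 2 * ((q / 2 : ℕ) : ℝ) := by
        exact_mod_cast (by omega : q = 2 * (q / 2))
      push_cast [this]
      ring
    rw [h3, Real.rpow_natCast, mul_pow, mul_comm]
    gcongr
    · norm_num
    · omega
  · intro s c _ _
    have h1 := class_card_le (n := n) (h := q / 2) c
    have h2 : (Nat.card {I : Fin p → Fin (q / 2) → Fin n // inC c I} : ℝ) *
        ∏ ℓ : Fin p, ∏ k : Fin s, (Nat.factorial (c k ℓ) : ℝ) ≤
        (n.choose s : ℝ) * (Nat.factorial (q / 2) : ℝ) ^ p := by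
      exact_mod_cast h1
    rw [le_div_iff₀ (Finset.prod_pos fun ℓ _ => Finset.prod_pos fun k _ => by positivity)]
    refine h2.trans ?_
    gcongr
    exact Nat.choose_le_pow_div s n
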